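/- Let R[ℤⁿ] be the group algebra of the lattice ℤⁿ over a unital ring R, let D be a bounded cochain complex of finitely generated free R[ℤⁿ]-modules which is R-finitely dominated, and let U ⊆ ℝⁿ be an ℝ-linear subspace spanned by elements of ℤⁿ. Then D is R[ℤⁿ ∩ U]-finitely dominated, where R[ℤⁿ ∩ U] is the group algebra of the subgroup ℤⁿ ∩ U, acting on D via the inclusion R[ℤⁿ ∩ U] ⊆ R[ℤⁿ]. -/

import Mathlib

open scoped TensorProduct

set_option synthInstance.maxHeartbeats 1000000
set_option maxHeartbeats 1600000

/-- A ℤ-graded module over a ring `S` with a degree-1 map; a cochain complex is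
such an object whose map squares to zero (`IsComplex` below). -/
structure Cplx (S : Type) [Ring S] : Type 1 where
  X : ℤ → Type
  [acg : ∀ i, AddCommGroup (X i)]
  [mod : ∀ i, Module S (X i)]
  d : ∀ (i j : ℤ), i + 1 = j → (X i →ₗ[S] X j)

attribute [instance] Cplx.acg Cplx.mod

variable {S : Type} [Ring S]

/-- `C` is a cochain complex: its differential squares to zero. -/
def Cplx.IsComplex (C : Cplx S) : Prop :=
  ∀ (i j k : ℤ) (h : i + 1 = j) (h' : j + 1 = k), (C.d j k h').comp (C.d i j h) = 0

/-- Cochain maps. -/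
structure CMap (C D : Cplx S) where
  app : ∀ i, C.X i →ₗ[S] D.X i
  comm : ∀ (i j : ℤ) (h : i + 1 = j), (D.d i j h).comp (app i) = (app j).comp (C.d i j h)

/-- The identity cochain map. -/
def CMap.id (C : Cplx S) : CMap C C :=
  ⟨fun _ => LinearMap.id, fun _ _ _ => rfl⟩

/-- Composition of cochain maps. -/
def CMap.comp {C D E : Cplx S} (g : CMap D E) (f : CMap C D) : CMap C E where
  app := fun i => (g.app i).comp (f.app i)
  comm := fun i j h => by
    rw [← LinearMap.comp_assoc, g.comm i j h, LinearMap.comp_assoc, f.comm i j h,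
      LinearMap.comp_assoc]

/-- A cochain homotopy between two cochain maps. -/
def CHomotopy {C D : Cplx S} (f g : CMap C D) : Prop :=
  ∃ s : ∀ (i j : ℤ), i = j + 1 → (C.X i →ₗ[S] D.X j),
    ∀ i : ℤ,
      (D.d (i - 1) i (by omega)).comp (s i (i - 1) (by omega)) +
          (s (i + 1) i rfl).comp (C.d i (i + 1) rfl) =
        f.app i - (g.app i)

/-- A complex is bounded if its modules vanish outside finitely many
degrees. -/
def Cplx.Bounded (C : Cplx S) : Prop :=
  ∃ a b : ℤ, ∀ i : ℤ, (i < a ∨ b < i) → Subsingleton (C.X i)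

/-- A complex of `S`-modules is `S`-finitely dominated if it is homotopy
equivalent to a bounded complex of finitely generated projective
`S`-modules. -/
def Cplx.FinitelyDominated (C : Cplx S) : Prop :=
  ∃ K : Cplx S, K.IsComplex ∧ K.Bounded ∧
    (∀ i : ℤ, Module.Finite S (K.X i) ∧ Module.Projective S (K.X i)) ∧
    ∃ (α : CMap C K) (β : CMap K C),
      CHomotopy (CMap.comp β α) (CMap.id C) ∧ CHomotopy (CMap.comp α β) (CMap.id K)

/-- `C` is acyclic: at each spot, every cocycle is a coboundary. -/
def Cplx.Acyclic (C : Cplx S) : Prop :=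
  ∀ (i j k : ℤ) (h : i + 1 = j) (h' : j + 1 = k) (x : C.X j),
    C.d j k h' x = 0 → ∃ y : C.X i, C.d i j h y = x

/-- `C` is contractible: the identity is null-homotopic. -/
def Cplx.Contractible (C : Cplx S) : Prop :=
  ∃ s : ∀ (i j : ℤ), i = j + 1 → (C.X i →ₗ[S] C.X j),
    ∀ i : ℤ,
      (C.d (i - 1) i (by omega)).comp (s i (i - 1) (by omega)) +
          (s (i + 1) i rfl).comp (C.d i (i + 1) rfl) = LinearMap.id

section OverL

variable {R₀ L₀ : Type} [CommRing R₀] [CommRing L₀] [Algebra R₀ L₀]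

/-- A cochain complex of `L`-modules, where `L` is an `R`-algebra, together
with the underlying compatible `R`-module structure (restriction of
scalars). -/
structure CplxOver (R₀ L₀ : Type) [CommRing R₀] [CommRing L₀] [Algebra R₀ L₀] : Type 1 where
  X : ℤ → Type
  [acg : ∀ i, AddCommGroup (X i)]
  [modL : ∀ i, Module L₀ (X i)]
  [modR : ∀ i, Module R₀ (X i)]
  [tower : ∀ i, IsScalarTower R₀ L₀ (X i)]
  d : ∀ (i j : ℤ), i + 1 = j → (X i →ₗ[L₀] X j)

attribute [instance] CplxOver.acg CplxOver.modL CplxOver.modR CplxOver.tower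

/-- The `L`-module complex underlying a `CplxOver`. -/
noncomputable def CplxOver.toCplx (D : CplxOver R₀ L₀) : Cplx L₀ where
  X := D.X
  d := D.d

/-- `D` is a cochain complex (the differential squares to zero). -/
def CplxOver.IsComplex (D : CplxOver R₀ L₀) : Prop :=
  ∀ (i j k : ℤ) (h : i + 1 = j) (h' : j + 1 = k), (D.d j k h').comp (D.d i j h) = 0

/-- The complex of `R`-modules obtained from `D` by restriction of scalars. -/
noncomputable def CplxOver.res (D : CplxOver R₀ L₀) : Cplx R₀ where
  X := D.X
  d := fun i j h => (D.d i j h).restrictScalars R₀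

end OverL

/-- The Laurent polynomial ring `L = R[x₁^{±1},…,xₙ^{±1}]`, i.e. the group
algebra `R[ℤⁿ]`. -/
abbrev Lring (R : Type) [CommRing R] (n : ℕ) : Type := AddMonoidAlgebra R (Fin n → ℤ)

variable (R : Type) [CommRing R] (n : ℕ)

/-- Restriction of scalars of a complex along a ring homomorphism
`φ : S →+* T`. -/
noncomputable def Cplx.resHom {S T : Type} [Ring S] [Ring T] (φ : S →+* T) (C : Cplx T) :
    Cplx S :=
  Cplx.mk (X := C.X) (acg := C.acg)
    (mod := fun i => Module.compHom (C.X i) φ)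
    (d := fun i j h =>
      letI : ∀ i, Module S (C.X i) := fun i => Module.compHom (C.X i) φ
      { toFun := C.d i j h
        map_add' := (C.d i j h).map_add
        map_smul' := fun s x => (C.d i j h).map_smul (φ s) x })

/-- The coordinatewise inclusion `ℤⁿ → ℝⁿ`. -/
noncomputable def intCastHom (n : ℕ) : (Fin n → ℤ) →+ (Fin n → ℝ) where
  toFun := fun v i => (v i : ℝ)
  map_zero' := by funext i; simp
  map_add' := fun v w => by funext i; push_cast; simp

/-- The subgroup `ℤⁿ ∩ U` of `ℤⁿ` determined by a subspace `U ⊆ ℝⁿ`. -/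
noncomputable def latticeInter (n : ℕ) (U : Submodule ℝ (Fin n → ℝ)) :
    AddSubgroup (Fin n → ℤ) :=
  AddSubgroup.comap (intCastHom n) U.toAddSubgroup

/-- The inclusion of group algebras `R[ℤⁿ ∩ U] ⊆ R[ℤⁿ]`. -/
noncomputable def groupAlgebraIncl (U : Submodule ℝ (Fin n → ℝ)) :
    AddMonoidAlgebra R (latticeInter n U) →+* Lring R n :=
  (AddMonoidAlgebra.mapDomainAlgHom R R ((latticeInter n U).subtype)).toRingHom

open CategoryTheory in
/-- A cochain complex of modules is perfect up to homotopy if it is homotopy equivalent to a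
bounded complex of finitely generated projective modules. -/
def HomotopyPerfect (A : Type) [Ring A] (C : CochainComplex (ModuleCat.{0} A) ℤ) : Prop :=
  ∃ K : CochainComplex (ModuleCat.{0} A) ℤ,
    (∃ a b : ℤ, ∀ i : ℤ, (i < a ∨ b < i) → Subsingleton (K.X i)) ∧
    (∀ i : ℤ, Module.Finite A (K.X i) ∧ Module.Projective A (K.X i)) ∧
    Nonempty (HomotopyEquiv C K)

namespace HomotopyPerfect

open CategoryTheory CategoryTheory.Pretriangulated

variable {A : Type} [Ring A]

lemma of_homotopyEquiv {C C' : CochainComplex (ModuleCat.{0} A) ℤ} (h : HomotopyPerfect A C)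
    (e : HomotopyEquiv C' C) : HomotopyPerfect A C' := by
  obtain ⟨K, hb, hK, ⟨e'⟩⟩ := h
  exact ⟨K, hb, hK, ⟨e.trans e'⟩⟩

lemma of_iso {C C' : CochainComplex (ModuleCat.{0} A) ℤ} (h : HomotopyPerfect A C)
    (e : C' ≅ C) : HomotopyPerfect A C' :=
  h.of_homotopyEquiv (HomotopyEquiv.ofIso e)

lemma map {B : Type} [Ring B] (F : ModuleCat.{0} A ⥤ ModuleCat.{0} B) [F.Additive]
    (hF : ∀ M : ModuleCat.{0} A, Module.Finite A M → Module.Projective A M →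
      Module.Finite B (F.obj M) ∧ Module.Projective B (F.obj M))
    {C : CochainComplex (ModuleCat.{0} A) ℤ} (h : HomotopyPerfect A C) :
    HomotopyPerfect B ((F.mapHomologicalComplex _).obj C) := by
  obtain ⟨K, ⟨a, b, hab⟩, hK, ⟨e⟩⟩ := h
  refine ⟨(F.mapHomologicalComplex _).obj K, ⟨a, b, fun i hi => ?_⟩,
    fun i => hF _ (hK i).1 (hK i).2, ⟨F.mapHomotopyEquiv e⟩⟩
  have := hab i hi
  exact ModuleCat.subsingleton_of_isZero (F.map_isZero (ModuleCat.isZero_of_subsingleton (K.X i)))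

lemma mappingCone {K L : CochainComplex (ModuleCat.{0} A) ℤ} (φ : K ⟶ L)
    (hK : ∃ a b : ℤ, ∀ i : ℤ, (i < a ∨ b < i) → Subsingleton (K.X i))
    (hK' : ∀ i : ℤ, Module.Finite A (K.X i) ∧ Module.Projective A (K.X i))
    (hL : ∃ a b : ℤ, ∀ i : ℤ, (i < a ∨ b < i) → Subsingleton (L.X i))
    (hL' : ∀ i : ℤ, Module.Finite A (L.X i) ∧ Module.Projective A (L.X i)) :
    HomotopyPerfect A (CochainComplex.mappingCone φ) := by
  obtain ⟨a, b, hab⟩ := hK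
  obtain ⟨a', b', hab'⟩ := hL
  have split : ∀ i : ℤ, ∃ (s : (CochainComplex.mappingCone φ).X i →ₗ[A] K.X (i + 1) × L.X i)
      (r : K.X (i + 1) × L.X i →ₗ[A] (CochainComplex.mappingCone φ).X i),
      r.comp s = LinearMap.id := by
    intro i
    refine ⟨LinearMap.prod ((CochainComplex.mappingCone.fst φ).1.v i (i + 1) rfl).hom
      ((CochainComplex.mappingCone.snd φ).v i i (add_zero i)).hom,
      LinearMap.coprod ((CochainComplex.mappingCone.inl φ).v (i + 1) i (by lia)).hom
        ((CochainComplex.mappingCone.inr φ).f i).hom, ?_⟩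
    have := CochainComplex.mappingCone.id_X φ i (i + 1) rfl
    ext x
    exact congr($(this).hom x)
  refine ⟨CochainComplex.mappingCone φ, ⟨min (a - 1) a', max b b', fun i hi => ?_⟩,
    fun i => ?_, ⟨HomotopyEquiv.refl _⟩⟩
  · obtain ⟨s, r, hrs⟩ := split i
    have := hab (i + 1) (by grind)
    have := hab' i (by grind)
    exact (LinearMap.injective_of_comp_eq_id s r hrs).subsingleton
  · obtain ⟨s, r, hrs⟩ := split i
    obtain ⟨_, _⟩ := hK' (i + 1)
    obtain ⟨_, _⟩ := hL' i
    exact ⟨Module.Finite.of_surjective r (LinearMap.surjective_of_comp_eq_id s r hrs),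
      Module.Projective.of_split s r hrs⟩

lemma of_degreewiseSplit (S : ShortComplex (CochainComplex (ModuleCat.{0} A) ℤ))
    (σ : ∀ n, (S.map (HomologicalComplex.eval _ _ n)).Splitting)
    (h₁ : HomotopyPerfect A S.X₁) (h₂ : HomotopyPerfect A S.X₂) : HomotopyPerfect A S.X₃ := by
  obtain ⟨K, hK, hK', ⟨e⟩⟩ := h₁
  obtain ⟨L, hL, hL', ⟨e'⟩⟩ := h₂
  let T := CochainComplex.trianglehOfDegreewiseSplit S σ
  have hT : T ∈ distTriang _ := by
    rw [rotate_distinguished_triangle, rotate_distinguished_triangle]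
    exact isomorphic_distinguished _
      (HomotopyCategory.mappingCone_triangleh_distinguished _) _
      (CochainComplex.trianglehOfDegreewiseSplitRotateRotateIso S σ)
  let i₁ := HomotopyCategory.isoOfHomotopyEquiv e
  let i₂ := HomotopyCategory.isoOfHomotopyEquiv e'
  obtain ⟨φ, hφ⟩ := (HomotopyCategory.quotient _ _).map_surjective (i₁.inv ≫ T.mor₁ ≫ i₂.hom)
  have := isoTriangleOfIso₁₂ T _ hT
    (HomotopyCategory.mappingCone_triangleh_distinguished φ) i₁ i₂ (by
      change T.mor₁ ≫ i₂.hom = i₁.hom ≫ (HomotopyCategory.quotient _ _).map φ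
      rw [hφ, Iso.hom_inv_id_assoc]
      rfl)
  exact (HomotopyPerfect.mappingCone φ hK hK' hL hL').of_homotopyEquiv
    (HomotopyCategory.homotopyEquivOfIso (Triangle.π₃.mapIso this))

end HomotopyPerfect

/-- Induction along a basis. -/
lemma basis_induction {A M ι : Type} [Ring A] [AddCommGroup M] [Module A M]
    (b : Module.Basis ι A M) {p : M → Prop} (zero : p 0)
    (add : ∀ x y, p x → p y → p (x + y)) (smul : ∀ (a : A) x, p x → p (a • x))
    (basis : ∀ i, p (b i)) (x : M) : p x :=
  Submodule.span_induction (p := fun x _ => p x) (by rintro _ ⟨i, rfl⟩; exact basis i) zero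
    (fun x y _ _ => add x y) (fun a x _ => smul a x) (b.mem_span x)

section LaurentResolution

open TensorProduct

variable {A B : Type} [CommRing A] [CommRing B] [Algebra A B] (t : Bˣ)
  (X : Type) [AddCommGroup X] [Module A X] [Module B X] [IsScalarTower A B X]

/-- The endomorphism `b ⊗ x ↦ t b ⊗ x - b ⊗ t x` of `B ⊗[A] X`. -/
noncomputable def twistedDifference : B ⊗[A] X →ₗ[B] B ⊗[A] X :=
  (t : B) • LinearMap.id - (Algebra.lsmul A A X (t : B)).baseChange B

/-- The action map `b ⊗ x ↦ b x` on `B ⊗[A] X`. -/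
noncomputable def actionMap (A B : Type) [CommRing A] [CommRing B] [Algebra A B]
    (X : Type) [AddCommGroup X] [Module A X] [Module B X] [IsScalarTower A B X] :
    B ⊗[A] X →ₗ[B] X :=
  TensorProduct.AlgebraTensorModule.lift
    { toFun := fun b => (Algebra.lsmul A A X b)
      map_add' := fun b c => by simp
      map_smul' := fun b c => by ext; simp }

lemma twistedDifference_tmul (b : B) (x : X) :
    twistedDifference t X (b ⊗ₜ[A] x) = ((t : B) * b) ⊗ₜ[A] x - b ⊗ₜ[A] ((t : B) • x) := by
  simp [twistedDifference, TensorProduct.smul_tmul']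

lemma actionMap_tmul (b : B) (x : X) : actionMap A B X (b ⊗ₜ[A] x) = b • x := by
  simp [actionMap]

lemma actionMap_surjective : Function.Surjective (actionMap A B X) :=
  fun x => ⟨1 ⊗ₜ x, by simp [actionMap_tmul]⟩

lemma actionMap_comp_twistedDifference :
    (actionMap A B X).comp (twistedDifference t X) = 0 := by
  ext x
  simp [twistedDifference_tmul, actionMap_tmul]

lemma actionMap_bijective (hAB : Function.Bijective (algebraMap A B)) :
    Function.Bijective (actionMap A B X) := by
  refine ⟨Function.LeftInverse.injective (g := fun x => (1 : B) ⊗ₜ[A] x) fun z => ?_,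
    actionMap_surjective X⟩
  induction z with
  | zero => simp
  | tmul c x =>
    obtain ⟨a, rfl⟩ := hAB.2 c
    dsimp only
    rw [actionMap_tmul, algebraMap_smul, ← TensorProduct.smul_tmul,
      Algebra.algebraMap_eq_smul_one]
  | add z w hz hw =>
    dsimp only at hz hw ⊢
    rw [map_add, TensorProduct.tmul_add, hz, hw]

variable {X} {Y : Type} [AddCommGroup Y] [Module A Y] [Module B Y] [IsScalarTower A B Y]

lemma actionMap_comp_baseChange (g : X →ₗ[B] Y) :
    (actionMap A B Y).comp ((g.restrictScalars A).baseChange B) = g.comp (actionMap A B X) := by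
  ext x
  simp [actionMap_tmul]

lemma twistedDifference_comp_baseChange (g : X →ₗ[B] Y) :
    (twistedDifference t Y).comp ((g.restrictScalars A).baseChange B) =
      ((g.restrictScalars A).baseChange B).comp (twistedDifference t X) := by
  ext x
  simp [twistedDifference_tmul]

variable {t} (X) (b : Module.Basis ℤ A B) (hb : ∀ k : ℤ, b k = ((t ^ k : Bˣ) : B))
include hb

lemma tmul_sub_one_tmul_smul_mem_range (c : B) (x : X) :
    c ⊗ₜ[A] x - 1 ⊗ₜ[A] (c • x) ∈ LinearMap.range (twistedDifference (A := A) t X) := by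
  induction c using basis_induction b generalizing x with
  | zero => simp
  | add c d hc hd =>
    have := add_mem (hc x) (hd x)
    rwa [sub_add_sub_comm, ← TensorProduct.add_tmul, ← TensorProduct.tmul_add, ← add_smul] at this
  | smul a c hc =>
    have := hc (a • x)
    rwa [TensorProduct.tmul_smul, TensorProduct.smul_tmul', smul_comm c a x,
      ← smul_assoc a c x] at this
  | basis k =>
    have step (k : ℤ) (x : X) : ((t ^ (k + 1) : Bˣ) : B) ⊗ₜ[A] x
        - ((t ^ k : Bˣ) : B) ⊗ₜ[A] ((t : B) • x) ∈
          LinearMap.range (twistedDifference (A := A) t X) :=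
      ⟨((t ^ k : Bˣ) : B) ⊗ₜ[A] x, by
        rw [twistedDifference_tmul, ← Units.val_mul, mul_comm, ← zpow_add_one]⟩
    rw [hb]
    induction k using Int.induction_on generalizing x with
    | zero => simp
    | succ k ih =>
      have := add_mem (step k x) (ih ((t : B) • x))
      rwa [sub_add_sub_cancel, ← mul_smul, ← Units.val_mul, ← zpow_add_one] at this
    | pred k ih =>
      have := sub_mem (ih (((t⁻¹ : Bˣ) : B) • x)) (step (-k - 1) (((t⁻¹ : Bˣ) : B) • x))
      rw [sub_add_cancel, sub_sub_sub_cancel_left, ← mul_smul, ← mul_smul, Units.mul_inv,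
        one_smul, ← Units.val_mul, ← zpow_sub_one] at this
      exact this

lemma range_twistedDifference :
    LinearMap.range (twistedDifference (A := A) t X) = LinearMap.ker (actionMap A B X) := by
  apply le_antisymm
  · rw [LinearMap.range_le_ker_iff]
    exact actionMap_comp_twistedDifference t X
  · intro z hz
    have key (z : B ⊗[A] X) : z - 1 ⊗ₜ[A] actionMap A B X z ∈
        LinearMap.range (twistedDifference (A := A) t X) := by
      induction z with
      | zero => simp
      | tmul c x =>
        rw [actionMap_tmul]
        exact tmul_sub_one_tmul_smul_mem_range X b hb c x
      | add z w hz hw =>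
        have := add_mem hz hw
        rwa [sub_add_sub_comm, ← TensorProduct.tmul_add, ← map_add] at this
    simpa [LinearMap.mem_ker.mp hz] using key z

lemma twistedDifference_injective : Function.Injective (twistedDifference (A := A) t X) := by
  let c := TensorProduct.equivFinsuppOfBasisLeft (N := X) b
  have repr_mul (d : B) (k : ℤ) : b.repr ((t : B) * d) (k + 1) = b.repr d k := by
    induction d using basis_induction b with
    | zero => simp
    | add c d hc hd => simp [mul_add, hc, hd]
    | smul a c hc => simp [hc]
    | basis j =>
      have : (t : B) * b j = b (j + 1) := by
        rw [hb, hb, ← Units.val_mul, mul_comm, ← zpow_add_one]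
      rw [this]
      simp [Finsupp.single_apply]
  have coord (z : B ⊗[A] X) (k : ℤ) :
      c (twistedDifference t X z) (k + 1) = c z k - (t : B) • c z (k + 1) := by
    induction z with
    | zero => simp
    | tmul d x =>
      rw [twistedDifference_tmul, map_sub, Finsupp.sub_apply]
      simp only [c, TensorProduct.equivFinsuppOfBasisLeft_apply_tmul_apply, repr_mul]
      rw [smul_comm]
    | add z w hz hw =>
      simp only [map_add, Finsupp.add_apply, hz, hw, smul_add]
      abel
  rw [injective_iff_map_eq_zero]
  intro z hz
  have succ (k : ℤ) : c z k = (t : B) • c z (k + 1) := by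
    rw [← sub_eq_zero, ← coord, hz, map_zero, Finsupp.zero_apply]
  have shift (k : ℤ) (m : ℕ) (h : c z (k + m) = 0) : c z k = 0 := by
    induction m with
    | zero => simpa using h
    | succ m ih =>
      apply ih
      rw [succ, add_assoc, ← Nat.cast_succ, h, smul_zero]
  obtain ⟨N, hN⟩ := (c z).support.bddAbove
  have : c z = 0 := by
    ext k
    apply shift k (N + 1 - k).toNat
    by_contra h
    have := hN (Finsupp.mem_support_iff.mpr h)
    lia
  exact c.map_eq_zero_iff.mp this

end LaurentResolution

section BaseChange

open CategoryTheory TensorProduct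

variable (A : Type) {B : Type} [CommRing A] [CommRing B] [Algebra A B]

/-- Base change of modules along an algebra, as a functor. -/
noncomputable def baseChangeFunctor (A B : Type) [CommRing A] [CommRing B] [Algebra A B] :
    ModuleCat.{0} A ⥤ ModuleCat.{0} B where
  obj M := ModuleCat.of B (B ⊗[A] M)
  map g := ModuleCat.ofHom (g.hom.baseChange B)
  map_id M := by ext; simp
  map_comp f g := by ext; simp

instance : (baseChangeFunctor A B).Additive where
  map_add {M N f g} := by
    exact ModuleCat.hom_ext (LinearMap.baseChange_add f.hom g.hom)

/-- Restriction of scalars of a cochain complex of `B`-modules which are compatibly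
`A`-modules. -/
noncomputable def restrictComplex (D : CochainComplex (ModuleCat.{0} B) ℤ)
    [∀ i, Module A (D.X i)] [∀ i, IsScalarTower A B (D.X i)] :
    CochainComplex (ModuleCat.{0} A) ℤ where
  X i := ModuleCat.of A (D.X i)
  d i j := ModuleCat.ofHom ((D.d i j).hom.restrictScalars A)
  shape i j h := by
    ext x
    simp [D.shape i j h]
  d_comp_d' i j k _ _ := by
    ext x
    exact congr($(D.d_comp_d i j k).hom x)

variable (D : CochainComplex (ModuleCat.{0} B) ℤ)
    [∀ i, Module A (D.X i)] [∀ i, IsScalarTower A B (D.X i)]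

/-- The base change to `B` of the restriction of scalars to `A` of `D`. -/
noncomputable abbrev inducedComplex : CochainComplex (ModuleCat.{0} B) ℤ :=
  ((baseChangeFunctor A B).mapHomologicalComplex _).obj (restrictComplex A D)

/-- The action maps, as a cochain map. -/
noncomputable def actionHom : inducedComplex A D ⟶ D where
  f i := ModuleCat.ofHom (X := B ⊗[A] D.X i) (Y := D.X i) (actionMap A B (D.X i))
  comm' i j _ := by
    refine ModuleCat.hom_ext ?_
    have := actionMap_comp_baseChange (A := A) (D.d i j).hom
    exact this.symm

/-- The twisted differences, as a cochain map. -/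
noncomputable def twistedDifferenceHom (t : Bˣ) : inducedComplex A D ⟶ inducedComplex A D where
  f i := ModuleCat.ofHom (X := B ⊗[A] D.X i) (Y := B ⊗[A] D.X i) (twistedDifference t (D.X i))
  comm' i j _ := by
    refine ModuleCat.hom_ext ?_
    have := twistedDifference_comp_baseChange (A := A) t (D.d i j).hom
    exact this.symm

namespace HomotopyPerfect

variable {A D}

lemma inducedComplex_of_restrictComplex (h : HomotopyPerfect A (restrictComplex A D)) :
    HomotopyPerfect B (inducedComplex A D) :=
  h.map _ fun M _ _ => ⟨inferInstanceAs (Module.Finite B (B ⊗[A] M)),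
    inferInstanceAs (Module.Projective B (B ⊗[A] M))⟩

lemma of_restrictComplex_of_bijective (hAB : Function.Bijective (algebraMap A B))
    (h : HomotopyPerfect A (restrictComplex A D)) : HomotopyPerfect B D := by
  have (i : ℤ) : IsIso ((actionHom A D).f i) :=
    (ConcreteCategory.isIso_iff_bijective _).mpr (actionMap_bijective (D.X i) hAB)
  exact h.inducedComplex_of_restrictComplex.of_iso (HomologicalComplex.Hom.isoOfComponents
    (fun i => asIso ((actionHom A D).f i)) fun i j _ => (actionHom A D).comm i j).symm

lemma of_restrictComplex_of_basis_zpow (t : Bˣ) (b : Module.Basis ℤ A B)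
    (hb : ∀ k : ℤ, b k = ((t ^ k : Bˣ) : B)) (hD : ∀ i, Module.Projective B (D.X i))
    (h : HomotopyPerfect A (restrictComplex A D)) : HomotopyPerfect B D := by
  have zero : twistedDifferenceHom A D t ≫ actionHom A D = 0 := by
    refine HomologicalComplex.hom_ext _ _ fun i => ModuleCat.hom_ext ?_
    exact actionMap_comp_twistedDifference (A := A) t (D.X i)
  refine of_degreewiseSplit (ShortComplex.mk _ _ zero) (fun i => ?_)
    h.inducedComplex_of_restrictComplex h.inducedComplex_of_restrictComplex
  have : Projective (D.X i) := (IsProjective.iff_projective (D.X i)).mp (hD i)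
  have exact : ((ShortComplex.mk _ _ zero).map
      (HomologicalComplex.eval (ModuleCat.{0} B) (ComplexShape.up ℤ) i)).ShortExact :=
    { exact := (ShortComplex.moduleCat_exact_iff_range_eq_ker _).mpr
        (range_twistedDifference (D.X i) b hb)
      mono_f := (ModuleCat.mono_iff_injective _).mpr (twistedDifference_injective (D.X i) b hb)
      epi_g := (ModuleCat.epi_iff_surjective _).mpr
        (actionMap_surjective (A := A) (B := B) (D.X i)) }
  exact @ShortComplex.ShortExact.splittingOfProjective _ _ _ _ exact this _

end HomotopyPerfect

end BaseChange

section GroupAlgebra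

open CategoryTheory

variable (k : Type) [CommRing k] {G M ι : Type} [AddCommGroup G] [AddCommGroup M]

/-- The homomorphism of group algebras induced by a homomorphism of abelian groups. -/
noncomputable abbrev groupAlgebraMap (φ : G →+ M) : AddMonoidAlgebra k G →+* AddMonoidAlgebra k M :=
  (AddMonoidAlgebra.mapDomainAlgHom k k φ).toRingHom

lemma groupAlgebraMap_single (φ : G →+ M) (g : G) (a : k) :
    groupAlgebraMap k φ (AddMonoidAlgebra.single g a) = AddMonoidAlgebra.single (φ g) a :=
  AddMonoidAlgebra.mapDomain_single

lemma exists_basis_groupAlgebra (φ : G →+ M) (T : ι → M)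
    (hT : Function.Bijective fun p : ι × G => φ p.2 + T p.1) :
    letI := (groupAlgebraMap k φ).toAlgebra
    ∃ b : Module.Basis ι (AddMonoidAlgebra k G) (AddMonoidAlgebra k M),
      ∀ i, b i = AddMonoidAlgebra.single (T i) 1 := by
  let := (groupAlgebraMap k φ).toAlgebra
  let v : ι → AddMonoidAlgebra k M := fun i => AddMonoidAlgebra.single (T i) 1
  let E : (ι →₀ AddMonoidAlgebra k G) ≃ₗ[k] AddMonoidAlgebra k M :=
    Finsupp.mapRange.linearEquiv (AddMonoidAlgebra.coeffLinearEquiv k) ≪≫ₗ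
      (Finsupp.curryLinearEquiv k).symm ≪≫ₗ Finsupp.domLCongr (Equiv.ofBijective _ hT) ≪≫ₗ
      (AddMonoidAlgebra.coeffLinearEquiv k).symm
  have hE : (Finsupp.linearCombination (AddMonoidAlgebra k G) v : _ → _) = E := by
    suffices (Finsupp.linearCombination (AddMonoidAlgebra k G) v).toAddMonoidHom =
        E.toLinearMap.toAddMonoidHom from congr($this)
    refine Finsupp.addHom_ext' fun i => AddMonoidAlgebra.addMonoidHom_ext fun g a => ?_
    have h₁ : AddMonoidAlgebra.single g a • v i = AddMonoidAlgebra.single (φ g + T i) a := by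
      rw [Algebra.smul_def, RingHom.algebraMap_toAlgebra, groupAlgebraMap_single]
      simp [v, AddMonoidAlgebra.single_mul_single]
    have h₂ : E (Finsupp.single i (AddMonoidAlgebra.single g a)) =
        AddMonoidAlgebra.single (φ g + T i) a := by
      simp [E]
    simp [h₁, h₂]
  have hbij : Function.Bijective (Finsupp.linearCombination (AddMonoidAlgebra k G) v) :=
    hE ▸ E.bijective
  exact ⟨.ofRepr (LinearEquiv.ofBijective _ hbij).symm, fun i => by
    change Finsupp.linearCombination (AddMonoidAlgebra k G) v (Finsupp.single i 1) = _
    simp [v]⟩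

/-- Restriction of scalars of a cochain complex along a ring homomorphism. -/
noncomputable abbrev restrictComplexAlong {A B : Type} [Ring A] [Ring B] (f : A →+* B)
    (D : CochainComplex (ModuleCat.{0} B) ℤ) : CochainComplex (ModuleCat.{0} A) ℤ :=
  ((ModuleCat.restrictScalars f).mapHomologicalComplex _).obj D

namespace HomotopyPerfect

section

variable {A B : Type} [CommRing A] [CommRing B] {f : A →+* B}
  {D : CochainComplex (ModuleCat.{0} B) ℤ}

lemma of_restrictComplexAlong_of_bijective (hf : Function.Bijective f)
    (h : HomotopyPerfect A (restrictComplexAlong f D)) : HomotopyPerfect B D := by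
  let := f.toAlgebra
  let (i : ℤ) : Module A (D.X i) := Module.compHom _ f
  have (i : ℤ) : IsScalarTower A B (D.X i) := .of_algebraMap_smul fun _ _ => rfl
  exact of_restrictComplex_of_bijective (A := A) hf h

lemma of_restrictComplexAlong_of_basis_zpow (t : Bˣ)
    (hf : letI := f.toAlgebra; ∃ b : Module.Basis ℤ A B, ∀ k : ℤ, b k = ((t ^ k : Bˣ) : B))
    (hD : ∀ i, Module.Projective B (D.X i))
    (h : HomotopyPerfect A (restrictComplexAlong f D)) : HomotopyPerfect B D := by
  let := f.toAlgebra
  let (i : ℤ) : Module A (D.X i) := Module.compHom _ f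
  have (i : ℤ) : IsScalarTower A B (D.X i) := .of_algebraMap_smul fun _ _ => rfl
  obtain ⟨b, hb⟩ := hf
  exact of_restrictComplex_of_basis_zpow (A := A) t b hb hD h

end

lemma restrictComplexAlong_groupAlgebraMap_cons (m : ℕ)
    {D : CochainComplex (ModuleCat.{0} (AddMonoidAlgebra k (Fin (m + 1) → ℤ))) ℤ}
    (hD : ∀ i, Module.Projective (AddMonoidAlgebra k (Fin (m + 1) → ℤ)) (D.X i))
    (ι : (Fin m → ℤ) →+ (Fin (m + 1) → ℤ)) (hι : ∀ v, ι v = Fin.cons 0 v)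
    (h : HomotopyPerfect _ (restrictComplexAlong (groupAlgebraMap k ι) D)) :
    HomotopyPerfect _ D := by
  let e : Fin (m + 1) → ℤ := Fin.cons 1 0
  let t : (AddMonoidAlgebra k (Fin (m + 1) → ℤ))ˣ :=
    Units.map (AddMonoidAlgebra.of k (Fin (m + 1) → ℤ)) (toUnits (Multiplicative.ofAdd e))
  have ht (i : ℤ) : ((t ^ i : (AddMonoidAlgebra k (Fin (m + 1) → ℤ))ˣ) :
      AddMonoidAlgebra k (Fin (m + 1) → ℤ)) = AddMonoidAlgebra.single (i • e) 1 := by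
    simp only [t, ← map_zpow, ← ofAdd_zsmul]
    rfl
  have hT : Function.Bijective fun p : ℤ × (Fin m → ℤ) => ι p.2 + p.1 • e := by
    have key (p : ℤ × (Fin m → ℤ)) : ι p.2 + p.1 • e = Fin.cons p.1 p.2 := by
      rw [hι]
      ext j
      cases j using Fin.cases <;> simp [e]
    simp only [key]
    exact (Fin.consEquiv fun _ : Fin (m + 1) => ℤ).bijective
  refine h.of_restrictComplexAlong_of_basis_zpow t ?_ hD
  simpa only [ht] using exists_basis_groupAlgebra k ι (fun i : ℤ => i • e) hT

lemma restrictComplexAlong_groupAlgebraMap_comp {G' : Type} [AddCommGroup G']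
    (ψ : G' →+ M) (φ : G →+ G')
    {D : CochainComplex (ModuleCat.{0} (AddMonoidAlgebra k M)) ℤ}
    (h : HomotopyPerfect _ (restrictComplexAlong (groupAlgebraMap k (ψ.comp φ)) D)) :
    HomotopyPerfect _ (restrictComplexAlong (groupAlgebraMap k φ)
      (restrictComplexAlong (groupAlgebraMap k ψ) D)) := by
  have : groupAlgebraMap k (ψ.comp φ) = (groupAlgebraMap k ψ).comp (groupAlgebraMap k φ) := by
    exact congr(($(AddMonoidAlgebra.mapDomainAlgHom_comp (R := k) (A := k) φ ψ)).toRingHom)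
  rw [this] at h
  exact h

end HomotopyPerfect

lemma projective_compHom_groupAlgebraMap {φ : G →+ M} (hφ : Function.Injective φ) (X : Type)
    [AddCommGroup X] [Module (AddMonoidAlgebra k M) X] [Module.Free (AddMonoidAlgebra k M) X] :
    letI := Module.compHom X (groupAlgebraMap k φ)
    Module.Projective (AddMonoidAlgebra k G) X := by
  let := (groupAlgebraMap k φ).toAlgebra
  let := Module.compHom X (groupAlgebraMap k φ)
  have : IsScalarTower (AddMonoidAlgebra k G) (AddMonoidAlgebra k M) X :=
    .of_algebraMap_smul fun _ _ => rfl
  have hT : Function.Bijective fun p : (M ⧸ φ.range) × G => φ p.2 + p.1.out := by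
    constructor
    · rintro ⟨q, g⟩ ⟨q', g'⟩ h
      dsimp only at h
      obtain rfl : q = q' := by
        have h0 (g : G) : ((φ g : M) : M ⧸ φ.range) = 0 :=
          (QuotientAddGroup.eq_zero_iff _).mpr ⟨g, rfl⟩
        have := congr(($h : M ⧸ φ.range))
        rwa [QuotientAddGroup.mk_add, QuotientAddGroup.mk_add, h0, h0, zero_add, zero_add,
          QuotientAddGroup.out_eq', QuotientAddGroup.out_eq'] at this
      rw [hφ (add_right_cancel h)]
    · intro x
      obtain ⟨g, hg⟩ : x - (x : M ⧸ φ.range).out ∈ φ.range :=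
        (QuotientAddGroup.eq_iff_sub_mem).mp (Quotient.out_eq' _).symm
      exact ⟨((x : M ⧸ φ.range), g), by simp [hg]⟩
  obtain ⟨b, -⟩ := exists_basis_groupAlgebra k φ (fun q : M ⧸ φ.range => q.out) hT
  have := Module.Free.of_basis b
  have := Module.Free.trans (R := AddMonoidAlgebra k G) (S := AddMonoidAlgebra k M) (M := X)
  infer_instance

namespace HomotopyPerfect

variable {D : CochainComplex (ModuleCat.{0} (AddMonoidAlgebra k M)) ℤ}

lemma restrictComplexAlong_groupAlgebraMap_of_pi
    (hD : ∀ i, Module.Free (AddMonoidAlgebra k M) (D.X i))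
    (h : HomotopyPerfect k (restrictComplexAlong (algebraMap k (AddMonoidAlgebra k M)) D))
    (m : ℕ) (φ : (Fin m → ℤ) →+ M) (hφ : Function.Injective φ) :
    HomotopyPerfect _ (restrictComplexAlong (groupAlgebraMap k φ) D) := by
  induction m with
  | zero =>
    refine of_restrictComplexAlong_of_bijective
      (f := algebraMap k (AddMonoidAlgebra k (Fin 0 → ℤ))) ?_ ?_
    · refine Function.bijective_iff_has_inverse.mpr
        ⟨fun x => x.coeff 0, fun a => by simp, fun x => ?_⟩
      refine AddMonoidAlgebra.ext (Finsupp.ext fun g => ?_)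
      rw [Subsingleton.elim g 0]
      simp
    · have : algebraMap k (AddMonoidAlgebra k M) =
          (groupAlgebraMap k φ).comp (algebraMap k (AddMonoidAlgebra k (Fin 0 → ℤ))) :=
        (AddMonoidAlgebra.mapDomainAlgHom k k φ).comp_algebraMap.symm
      rw [this] at h
      exact h
  | succ m ih =>
    let ι : (Fin m → ℤ) →+ (Fin (m + 1) → ℤ) :=
      { toFun v := Fin.cons 0 v
        map_zero' := by ext j; cases j using Fin.cases <;> simp
        map_add' v w := by ext j; cases j using Fin.cases <;> simp }
    have hι : Function.Injective ι :=
      Fin.cons_right_injective (α := fun _ => ℤ) 0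
    exact restrictComplexAlong_groupAlgebraMap_cons k m
      (fun i => projective_compHom_groupAlgebraMap k hφ (D.X i)) ι (fun _ => rfl)
      (restrictComplexAlong_groupAlgebraMap_comp k φ ι (ih (φ.comp ι) (hφ.comp hι)))

lemma restrictComplexAlong_groupAlgebraMap_subtype (H : AddSubgroup M) [Module.Free ℤ M]
    [Module.Finite ℤ M] (hD : ∀ i, Module.Free (AddMonoidAlgebra k M) (D.X i))
    (h : HomotopyPerfect k (restrictComplexAlong (algebraMap k (AddMonoidAlgebra k M)) D)) :
    HomotopyPerfect _ (restrictComplexAlong (groupAlgebraMap k H.subtype) D) := by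
  let e : H ≃+ (Fin (Module.finrank ℤ H.toIntSubmodule) → ℤ) :=
    (Module.finBasis ℤ H.toIntSubmodule).equivFun.toAddEquiv
  refine of_restrictComplexAlong_of_bijective (f := groupAlgebraMap k e.symm.toAddMonoidHom)
    (AddMonoidAlgebra.domCongr k k e.symm).bijective ?_
  exact restrictComplexAlong_groupAlgebraMap_comp k H.subtype e.symm.toAddMonoidHom
    (restrictComplexAlong_groupAlgebraMap_of_pi k hD h _ _
      (H.subtype_injective.comp e.symm.injective))

end HomotopyPerfect

end GroupAlgebra

section Comparison

open CategoryTheory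

/-- The cochain complex in the category of modules attached to a `Cplx`. -/
noncomputable def Cplx.IsComplex.toCochainComplex {C : Cplx S} (hC : C.IsComplex) :
    CochainComplex (ModuleCat.{0} S) ℤ where
  X i := ModuleCat.of S (C.X i)
  d i j := if h : i + 1 = j then ModuleCat.ofHom (C.d i j h) else 0
  shape i j h := dif_neg h
  d_comp_d' i j l hij hjl := by
    rw [dif_pos (show i + 1 = j from hij), dif_pos (show j + 1 = l from hjl),
      ← ModuleCat.ofHom_comp, hC i j l hij hjl]
    rfl

lemma Cplx.IsComplex.toCochainComplex_d {C : Cplx S} (hC : C.IsComplex) {i j : ℤ}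
    (h : i + 1 = j) : hC.toCochainComplex.d i j = ModuleCat.ofHom (C.d i j h) :=
  dif_pos h

/-- The cochain map in the category of modules attached to a `CMap`. -/
noncomputable def CMap.toHom {C D : Cplx S} (f : CMap C D) (hC : C.IsComplex)
    (hD : D.IsComplex) : hC.toCochainComplex ⟶ hD.toCochainComplex where
  f i := ModuleCat.ofHom (f.app i)
  comm' i j h := by
    rw [hC.toCochainComplex_d h, hD.toCochainComplex_d h]
    exact congr(ModuleCat.ofHom $(f.comm i j h))

lemma CHomotopy.nonempty_homotopy {C D : Cplx S} {f g : CMap C D} (h : CHomotopy f g)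
    (hC : C.IsComplex) (hD : D.IsComplex) :
    Nonempty (Homotopy (f.toHom hC hD) (g.toHom hC hD)) := by
  obtain ⟨s, hs⟩ := h
  let H (i j : ℤ) : hC.toCochainComplex.X i ⟶ hD.toCochainComplex.X j :=
    if h : i = j + 1 then ModuleCat.ofHom (s i j h) else 0
  have hH (i j : ℤ) (h : i = j + 1) : H i j = ModuleCat.ofHom (s i j h) := dif_pos h
  refine ⟨{ hom := H, zero := fun i j h => dif_neg fun h' => h h'.symm, comm := fun i => ?_ }⟩
  rw [dNext_eq H (show (ComplexShape.up ℤ).Rel i (i + 1) from rfl),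
    prevD_eq H (show (ComplexShape.up ℤ).Rel (i - 1) i by simp), hH _ _ rfl,
    hH i (i - 1) (sub_add_cancel i 1).symm, hC.toCochainComplex_d rfl,
    hD.toCochainComplex_d (sub_add_cancel i 1)]
  refine ModuleCat.hom_ext ?_
  have := eq_add_of_sub_eq (hs i).symm
  rw [add_comm (LinearMap.comp _ _)] at this
  exact this

/-- The `Cplx` underlying a cochain complex in the category of modules. -/
noncomputable def Cplx.ofCochainComplex (K : CochainComplex (ModuleCat.{0} S) ℤ) : Cplx S where
  X i := K.X i
  d i j _ := (K.d i j).hom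

lemma Cplx.isComplex_ofCochainComplex (K : CochainComplex (ModuleCat.{0} S) ℤ) :
    (Cplx.ofCochainComplex K).IsComplex :=
  fun i j l _ _ => congr(($(K.d_comp_d i j l)).hom)

lemma Cplx.IsComplex.finitelyDominated_iff {C : Cplx S} (hC : C.IsComplex) :
    C.FinitelyDominated ↔ HomotopyPerfect S hC.toCochainComplex := by
  constructor
  · rintro ⟨K, hK, hb, hK', α, β, h₁, h₂⟩
    obtain ⟨H₁⟩ := h₁.nonempty_homotopy hC hC
    obtain ⟨H₂⟩ := h₂.nonempty_homotopy hK hK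
    exact ⟨hK.toCochainComplex, hb, hK', ⟨⟨α.toHom hC hK, β.toHom hK hC, H₁, H₂⟩⟩⟩
  · rintro ⟨K, hb, hK, ⟨e⟩⟩
    refine ⟨Cplx.ofCochainComplex K, Cplx.isComplex_ofCochainComplex K, hb, hK,
      ⟨fun i => (e.hom.f i).hom, fun i j h => ?_⟩, ⟨fun i => (e.inv.f i).hom, fun i j h => ?_⟩,
      ⟨fun i j _ => (e.homotopyHomInvId.hom i j).hom, fun i => ?_⟩,
      ⟨fun i j _ => (e.homotopyInvHomId.hom i j).hom, fun i => ?_⟩⟩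
    · have := e.hom.comm i j
      rw [hC.toCochainComplex_d h] at this
      exact congr(($this).hom)
    · have := e.inv.comm i j
      rw [hC.toCochainComplex_d h] at this
      exact congr(($this).hom)
    · have := e.homotopyHomInvId.comm i
      rw [dNext_eq _ (show (ComplexShape.up ℤ).Rel i (i + 1) from rfl),
        prevD_eq _ (show (ComplexShape.up ℤ).Rel (i - 1) i by simp), add_comm (_ ≫ _),
        ← sub_eq_iff_eq_add, hC.toCochainComplex_d rfl,
        hC.toCochainComplex_d (sub_add_cancel i 1)] at this
      exact congr(($this).hom).symm
    · have := e.homotopyInvHomId.comm i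
      rw [dNext_eq _ (show (ComplexShape.up ℤ).Rel i (i + 1) from rfl),
        prevD_eq _ (show (ComplexShape.up ℤ).Rel (i - 1) i by simp), add_comm (_ ≫ _),
        ← sub_eq_iff_eq_add] at this
      exact congr(($this).hom).symm

lemma Cplx.IsComplex.resHom {A B : Type} [Ring A] [Ring B] {C : Cplx B} (hC : C.IsComplex)
    (f : A →+* B) : (C.resHom f).IsComplex :=
  fun i j l hij hjl => LinearMap.ext fun x => congr($(hC i j l hij hjl) x)

/-- Restricting scalars commutes with passing to the category of modules. -/
noncomputable def Cplx.IsComplex.resHomIso {A B : Type} [Ring A] [Ring B] {C : Cplx B}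
    (hC : C.IsComplex) (f : A →+* B) :
    (hC.resHom f).toCochainComplex ≅ restrictComplexAlong f hC.toCochainComplex :=
  HomologicalComplex.Hom.isoOfComponents (fun _ => Iso.refl _) fun i j h => by
    have : (restrictComplexAlong f hC.toCochainComplex).d i j =
        (hC.resHom f).toCochainComplex.d i j := by
      rw [(hC.resHom f).toCochainComplex_d h]
      change (ModuleCat.restrictScalars f).map (hC.toCochainComplex.d i j) = _
      rw [hC.toCochainComplex_d h]
      rfl
    rw [this]
    exact (Category.id_comp _).trans (Category.comp_id _).symm

/-- The restriction of scalars of a complex over an algebra agrees with the one along the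
structure map. -/
noncomputable def CplxOver.resIso {A B : Type} [CommRing A] [CommRing B] [Algebra A B]
    (D : CplxOver A B) (hD : D.toCplx.IsComplex) (hD' : D.res.IsComplex) :
    restrictComplexAlong (algebraMap A B) hD.toCochainComplex ≅ hD'.toCochainComplex :=
  HomologicalComplex.Hom.isoOfComponents
    (fun i => LinearEquiv.toModuleIso <|
      @AddEquiv.toLinearEquiv A (D.X i) (D.X i) _ _ _ (Module.compHom _ (algebraMap A B)) _
        (AddEquiv.refl _) fun a x => algebraMap_smul B a x)
    fun i j h => by
      refine ModuleCat.hom_ext (LinearMap.ext fun x => ?_)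
      rw [hD'.toCochainComplex_d h]
      change D.d i j h x = hD.toCochainComplex.d i j x
      rw [hD.toCochainComplex_d h]
      rfl

end Comparison

/-- Let `R[ℤⁿ]` be the group algebra of the lattice `ℤⁿ`
over `R` (the Laurent polynomial ring in `n` variables), let `D` be a bounded
cochain complex of finitely generated free `R[ℤⁿ]`-modules which is
`R`-finitely dominated, and let `U ⊆ ℝⁿ` be an ℝ-linear subspace spanned by
elements of `ℤⁿ`. Then `D` is `R[ℤⁿ ∩ U]`-finitely dominated, where
`R[ℤⁿ ∩ U]` acts on `D` via the inclusion `R[ℤⁿ ∩ U] ⊆ R[ℤⁿ]`. -/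
theorem finitelyDominated_over_sublattice
    (D : CplxOver R (Lring R n)) (hcx : D.IsComplex)
    (hbdd : D.toCplx.Bounded)
    (hfree : ∀ i : ℤ, Module.Free (Lring R n) (D.X i) ∧ Module.Finite (Lring R n) (D.X i))
    (hfd : D.res.FinitelyDominated)
    (U : Submodule ℝ (Fin n → ℝ))
    (hU : ∃ s : Set (Fin n → ℤ), U = Submodule.span ℝ (intCastHom n '' s)) :
    (Cplx.resHom (groupAlgebraIncl R n U) D.toCplx).FinitelyDominated := by
  have hres : D.res.IsComplex :=
    fun i j l hij hjl => LinearMap.ext fun x => congr($(hcx i j l hij hjl) x)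
  have hD : D.toCplx.IsComplex := hcx
  have perfect := (hres.finitelyDominated_iff.mp hfd).of_iso (D.resIso hD hres)
  rw [(hD.resHom (groupAlgebraIncl R n U)).finitelyDominated_iff]
  exact (HomotopyPerfect.restrictComplexAlong_groupAlgebraMap_subtype R (latticeInter n U)
    (fun i => (hfree i).1) perfect).of_iso (hD.resHomIso _)
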